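/- Independence of the mirror option value from the allowed number of mirrorings before exhaustion: for a monotone payoff, if at time T-τ the holder has performed strictly fewer than M mirrorings (M ≥ 1), then q*±(τ, M) = ν(x*_{T-τ} + (σ²/2 ± |α - σ²/2|)τ, σ²τ), which does not depend on M; in particular at inception all mirror options with M ≥ 1 allowed mirrorings have the same value, equal to the unrestricted (M = ∞) mirror option value. -/

import Mathlib

open MeasureTheory

/-- Gaussian smoothing of the payoff `f` in log-coordinates, extended to variance `0`. -/
noncomputable def nu (f : ℝ → ℝ) (z s : ℝ) : ℝ :=
  if s = 0 then f (Real.exp z)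
  else (Real.sqrt (2 * Real.pi * s))⁻¹ *
    ∫ x : ℝ, f (Real.exp x) * Real.exp (-(x - z + s/2)^2 / (2*s))

open ProbabilityTheory
open scoped NNReal

namespace MirrorOption

/-- The mean of `g` under the normal law with mean `m` and variance `v`. -/
noncomputable def gaussMean (g : ℝ → ℝ) (m : ℝ) (v : ℝ≥0) : ℝ :=
  ∫ x, g x ∂gaussianReal m v

lemma gaussMean_eq_integral (g : ℝ → ℝ) (m : ℝ) {v : ℝ≥0} (hv : v ≠ 0) :
    gaussMean g m v = (√(2 * Real.pi * v))⁻¹ *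
      ∫ x, g x * Real.exp (-(x - m) ^ 2 / (2 * v)) := by
  rw [gaussMean, integral_gaussianReal_eq_integral_smul hv, ← integral_const_mul]
  refine integral_congr_ae (.of_forall fun x => ?_)
  simp only [gaussianPDFReal, smul_eq_mul]
  ring

lemma integrable_gaussianReal {g : ℝ → ℝ} {m : ℝ} {v : ℝ≥0}
    (h : 0 < v → Integrable fun x => g x * Real.exp (-(x - m) ^ 2 / (2 * v))) :
    Integrable g (gaussianReal m v) := by
  rcases eq_or_ne v 0 with rfl | hv
  · rw [gaussianReal_zero_var]
    exact integrable_dirac enorm_lt_top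
  · rw [gaussianReal_of_var_ne_zero _ hv,
      integrable_withDensity_iff_integrable_smul' (measurable_gaussianPDF _ _)
        (.of_forall fun _ => gaussianPDF_lt_top)]
    refine ((h (pos_iff_ne_zero.2 hv)).const_mul (√(2 * Real.pi * v))⁻¹).congr
      (.of_forall fun x => ?_)
    simp only [toReal_gaussianPDF, gaussianPDFReal, smul_eq_mul]
    ring

lemma gaussMean_eq_shift (g : ℝ → ℝ) (m : ℝ) (v : ℝ≥0) :
    gaussMean g m v = ∫ x, g (x + m) ∂gaussianReal 0 v := by
  have h := gaussianReal_map_add_const (μ := 0) (v := v) m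
  rw [zero_add] at h
  rw [gaussMean, ← h, (measurableEmbedding_addRight m).integral_map]

lemma gaussMean_mono {g : ℝ → ℝ} (hg : ∀ m v, Integrable g (gaussianReal m v))
    (hmono : Monotone g) (v : ℝ≥0) : Monotone fun m => gaussMean g m v := by
  have hi (m : ℝ) : Integrable (fun x => g (x + m)) (gaussianReal 0 v) := by
    have h := hg m v
    rwa [← zero_add m, ← gaussianReal_map_add_const (μ := 0) (v := v) m,
      (measurableEmbedding_addRight m).integrable_map_iff] at h
  intro a b hab
  simp only [gaussMean_eq_shift g]
  exact integral_mono (hi a) (hi b) fun x => hmono (by linarith)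

lemma gaussMean_anti {g : ℝ → ℝ} (hg : ∀ m v, Integrable g (gaussianReal m v))
    (hanti : Antitone g) (v : ℝ≥0) : Antitone fun m => gaussMean g m v := by
  have h := gaussMean_mono (fun m v => (hg m v).neg) hanti.neg v
  intro a b hab
  have := h hab
  simpa [gaussMean, integral_neg] using this

lemma gaussMean_gaussMean {g : ℝ → ℝ} (hg : ∀ m v, Integrable g (gaussianReal m v))
    (y b : ℝ) (v w : ℝ≥0) :
    gaussMean (fun u => gaussMean g (y + u) v) b w = gaussMean g (y + b) (v + w) := by
  have h := hg (b + y) (w + v)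
  rw [add_comm y b, add_comm v w, gaussMean, gaussMean]
  rw [← gaussianReal_conv_gaussianReal] at h ⊢
  rw [integral_conv h]
  congr 1 with u
  have h' := gaussianReal_map_const_add (μ := y) (v := v) u
  rw [gaussMean, ← h', (measurableEmbedding_addLeft u).integral_map]

lemma gaussMean_comp_neg (g : ℝ → ℝ) (b : ℝ) (w : ℝ≥0) :
    gaussMean (fun u => g (-u)) b w = gaussMean g (-b) w := by
  rw [gaussMean, gaussMean, ← gaussianReal_map_neg]
  exact ((MeasurableEquiv.neg ℝ).measurableEmbedding.integral_map g).symm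

lemma gaussMean_gaussMean_sign {g : ℝ → ℝ} (hg : ∀ m v, Integrable g (gaussianReal m v))
    {s : ℝ} (hs : s = 1 ∨ s = -1) (y b : ℝ) (v w : ℝ≥0) :
    gaussMean (fun u => gaussMean g (y + s * u) v) b w =
      gaussMean g (y + s * b) (v + w) := by
  rcases hs with rfl | rfl
  · simpa using gaussMean_gaussMean hg y b v w
  · simpa [← gaussMean_gaussMean hg] using
      gaussMean_comp_neg (fun u => gaussMean g (y + u) v) b w

/-- The mirror option recursion, solved in terms of the preferred drift `c = ± β`. -/
lemma value_eq_gaussMean {g : ℝ → ℝ} (hg : ∀ m v, Integrable g (gaussianReal m v))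
    {β c ε : ℝ} {w : ℝ≥0} (hε : 0 ≤ ε) (hc : c = β ∨ c = -β)
    (hpref : ∀ v x t, 0 ≤ t → gaussMean g (x - c * t) v ≤ gaussMean g (x + c * t) v)
    {M : ℕ} {Q : ℕ → ℕ → ℝ → ℝ} (h0 : ∀ k y, Q 0 k y = g y)
    (hfree : ∀ n k y, k < M → Q (n + 1) k y =
      max (gaussMean (fun u => Q n k (y + (-1) ^ k * u)) (β * ε) w)
        (gaussMean (fun u => Q n (k + 1) (y - (-1) ^ k * u)) (β * ε) w))
    (hfull : ∀ n y, Q (n + 1) M y =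
      gaussMean (fun u => Q n M (y + (-1) ^ M * u)) (β * ε) w) (n : ℕ) :
    (∀ k y, k < M → Q n k y = gaussMean g (y + c * (n * ε)) (n * w)) ∧
      ∀ y, Q n M y = gaussMean g (y + (-1) ^ M * β * (n * ε)) (n * w) := by
  induction n with
  | zero => simp [h0, gaussMean]
  | succ n ih =>
    obtain ⟨ihfree, ihfull⟩ := ih
    have hw : ((n + 1 : ℕ) : ℝ≥0) * w = n * w + w := by push_cast; ring
    have hstep (d s y : ℝ) (hs : s = 1 ∨ s = -1) :
        gaussMean (fun u => gaussMean g (y + s * u + d) (n * w)) (β * ε) w =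
          gaussMean g (y + d + s * (β * ε)) ((n + 1 : ℕ) * w) := by
      rw [hw, ← gaussMean_gaussMean_sign hg hs]
      congr 1 with u
      congr 1
      ring
    have hle {v : ℝ≥0} {a b : ℝ} (x t : ℝ) (ht : 0 ≤ t) (ha : a = x - c * t)
        (hb : b = x + c * t) : gaussMean g a v ≤ gaussMean g b v :=
      ha ▸ hb ▸ hpref v x t ht
    refine ⟨fun k y hk => ?_, fun y => ?_⟩
    · have hs : (-1 : ℝ) ^ k = 1 ∨ (-1 : ℝ) ^ k = -1 := neg_one_pow_eq_or ℝ k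
      have hs' : -(-1 : ℝ) ^ k = 1 ∨ -(-1 : ℝ) ^ k = -1 := by
        rcases hs with h | h <;> simp [h]
      have hMk : k + 1 = M → (-1 : ℝ) ^ M = -(-1 : ℝ) ^ k := by
        rintro rfl
        ring
      have hdir : (-1 : ℝ) ^ k * β = c ∨ -(-1 : ℝ) ^ k * β = c := by
        rcases hs with h | h <;> rcases hc with rfl | rfl <;> simp [h]
      obtain ⟨d, hmirror, hd⟩ : ∃ d, (∀ x, Q n (k + 1) x = gaussMean g (x + d) (n * w)) ∧
          (d = c * (n * ε) ∨ d = -(-1) ^ k * β * (n * ε)) := by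
        rcases (Nat.succ_le_of_lt hk).lt_or_eq with h | h
        · exact ⟨_, fun x => ihfree _ x h, .inl rfl⟩
        · have h : k + 1 = M := h
          refine ⟨_, fun x => ?_, .inr rfl⟩
          rw [h, ihfull, hMk h]
      have hn : (0 : ℝ) ≤ n := n.cast_nonneg
      rw [hfree n k y hk]
      generalize (-1 : ℝ) ^ k = s at hs hs' hdir hd ⊢
      have e1 := hstep (c * (n * ε)) s y hs
      have e2 := hstep d (-s) y hs'
      simp only [ihfree k _ hk, hmirror, sub_eq_add_neg, ← neg_mul, e1, e2]
      push_cast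
      rcases hdir with h | h
      · have e3 : y + c * (n * ε) + s * (β * ε) = y + c * ((n + 1) * ε) := by
          rw [← h]; ring
        rw [e3, max_eq_left]
        rcases hd with rfl | rfl
        · exact hle (y + c * (n * ε)) ε hε (by rw [← h]; ring) (by ring)
        · exact hle y ((n + 1) * ε) (by positivity) (by rw [← h]; ring) rfl
      · have e3 : y + d + -s * (β * ε) = y + c * ((n + 1) * ε) := by
          rcases hd with rfl | rfl <;> rw [← h] <;> ring
        rw [e3, max_eq_right]
        exact hle (y + c * (n * ε)) ε hε (by rw [← h]; ring) (by ring)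
    · rw [hfull]
      simp only [ihfull, hstep _ _ y (neg_one_pow_eq_or ℝ M)]
      congr 1
      push_cast
      ring

lemma nu_eq_gaussMean (f : ℝ → ℝ) (z : ℝ) (v : ℝ≥0) :
    nu f z v = gaussMean (fun x => f (Real.exp x)) (z - v / 2) v := by
  rcases eq_or_ne v 0 with rfl | hv
  · simp [nu, gaussMean]
  · rw [nu, if_neg (by exact_mod_cast hv), gaussMean_eq_integral _ _ hv]
    simp only [sub_sub_eq_add_sub, add_sub_right_comm]

end MirrorOption

open MirrorOption

/-- Before exhaustion, the value of a mirror option with at most `M ≥ 1` allowed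
mirrorings does not depend on `M` and equals the unrestricted mirror option value:
`q*±(τ, M) = ν(x* + (σ²/2 ± |α - σ²/2|)τ, σ²τ)` whenever strictly fewer than `M`
mirrorings have been used.  Here `Q n k y` is the value with `n` steps to maturity,
`k` mirrorings already used, and current log mirror underlying `y`. -/
theorem finite_mirrorings_value (f : ℝ → ℝ)
    (hint : ∀ z s : ℝ, 0 < s →
      Integrable (fun x : ℝ => f (Real.exp x) * Real.exp (-(x - z + s/2)^2 / (2*s))))
    (σ r δ ε α : ℝ) (hσ : 0 < σ) (hε : 0 < ε) (hα : α = r - δ)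
    (M : ℕ) (hM : 1 ≤ M) (Q : ℕ → ℕ → ℝ → ℝ)
    (hQ0 : ∀ k y, Q 0 k y = f (Real.exp y))
    (hQrecFree : ∀ n k y, k < M → Q (n+1) k y =
      max ((σ * Real.sqrt (2 * Real.pi * ε))⁻¹ *
             ∫ u : ℝ, Q n k (y + (-1:ℝ)^k * u) *
               Real.exp (-(u - α*ε + σ^2*ε/2)^2 / (2*σ^2*ε)))
          ((σ * Real.sqrt (2 * Real.pi * ε))⁻¹ *
             ∫ u : ℝ, Q n (k+1) (y - (-1:ℝ)^k * u) *
               Real.exp (-(u - α*ε + σ^2*ε/2)^2 / (2*σ^2*ε))))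
    (hQrecFull : ∀ n y, Q (n+1) M y =
      (σ * Real.sqrt (2 * Real.pi * ε))⁻¹ *
        ∫ u : ℝ, Q n M (y + (-1:ℝ)^M * u) *
          Real.exp (-(u - α*ε + σ^2*ε/2)^2 / (2*σ^2*ε))) :
    (MonotoneOn f (Set.Ioi 0) →
      ∀ n k y, k < M →
        Q n k y = nu f (y + (σ^2/2 + |α - σ^2/2|) * (n*ε)) (σ^2*(n*ε))) ∧
    (AntitoneOn f (Set.Ioi 0) →
      ∀ n k y, k < M →
        Q n k y = nu f (y + (σ^2/2 - |α - σ^2/2|) * (n*ε)) (σ^2*(n*ε))) := by 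
  have hg : ∀ m v, Integrable (fun x => f (Real.exp x)) (gaussianReal m v) := fun m v =>
    integrable_gaussianReal fun hv => by
      simpa only [← sub_sub, sub_add_cancel] using hint (m + v / 2) v hv
  lift σ to ℝ≥0 using hσ.le
  lift ε to ℝ≥0 using hε.le
  have hw : σ ^ 2 * ε ≠ 0 := by
    have h1 : 0 < σ := hσ
    have h2 : 0 < ε := hε
    positivity
  have hker (h : ℝ → ℝ) : ((σ : ℝ) * √(2 * Real.pi * ε))⁻¹ *
      ∫ u : ℝ, h u * Real.exp (-(u - α*ε + σ^2*ε/2)^2 / (2*σ^2*ε)) =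
        gaussMean h ((α - σ ^ 2 / 2) * ε) (σ ^ 2 * ε) := by
    rw [gaussMean_eq_integral _ _ hw]
    push_cast
    congr 2
    · rw [show 2 * Real.pi * ((σ : ℝ) ^ 2 * ε) = σ ^ 2 * (2 * Real.pi * ε) by ring,
        Real.sqrt_mul (sq_nonneg (σ : ℝ)), Real.sqrt_sq hσ.le]
    · ext u
      congr 3 <;> ring
  simp only [hker] at hQrecFree hQrecFull
  have hnu (n : ℕ) (y c : ℝ) : nu f (y + (σ ^ 2 / 2 + c) * (n * ε)) (σ ^ 2 * (n * ε)) =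
      gaussMean (fun x => f (Real.exp x)) (y + c * (n * ε)) (n * (σ ^ 2 * ε)) := by
    rw [show (σ : ℝ) ^ 2 * (n * ε) = (n * (σ ^ 2 * ε) : ℝ≥0) by push_cast; ring,
      nu_eq_gaussMean]
    congr 1
    push_cast
    ring
  refine ⟨fun hf n k y hk => ?_, fun hf n k y hk => ?_⟩
  · have hmono : Monotone fun x => f (Real.exp x) := fun a b hab =>
      hf (Real.exp_pos a) (Real.exp_pos b) (Real.exp_le_exp.2 hab)
    rw [hnu]
    refine (value_eq_gaussMean hg hε.le (abs_choice (α - (σ : ℝ) ^ 2 / 2)) (fun v x t ht => ?_)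
      hQ0 hQrecFree hQrecFull n).1 k y hk
    have : 0 ≤ |α - (σ : ℝ) ^ 2 / 2| * t := by positivity
    exact gaussMean_mono hg hmono v (by linarith)
  · have hanti : Antitone fun x => f (Real.exp x) := fun a b hab =>
      hf (Real.exp_pos a) (Real.exp_pos b) (Real.exp_le_exp.2 hab)
    rw [sub_eq_add_neg, hnu]
    have hc : -|α - (σ : ℝ) ^ 2 / 2| = α - (σ : ℝ) ^ 2 / 2 ∨
        -|α - (σ : ℝ) ^ 2 / 2| = -(α - (σ : ℝ) ^ 2 / 2) := by
      rw [neg_inj, neg_eq_iff_eq_neg]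
      exact (abs_choice _).symm
    refine (value_eq_gaussMean hg hε.le hc (fun v x t ht => ?_)
      hQ0 hQrecFree hQrecFull n).1 k y hk
    have : 0 ≤ |α - (σ : ℝ) ^ 2 / 2| * t := by positivity
    exact gaussMean_anti hg hanti v (by linarith)
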